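/- Let d≥1 and α≥1. Suppose (x,v) is a C¹ solution of the Cucker–Smale system with singular communication weight ψ(s)=s^{-α} on the interval [0,t₀) such that the initial positions are pairwise distinct (x_i(0)≠x_j(0) for all i≠j) and the positions remain pairwise distinct on [0,t₀). Then t₀ cannot be a first collision time: the continuous extensions of the trajectories to t=t₀ still satisfy x_i(t₀)≠x_j(t₀) for all i≠j. Consequently, for pairwise distinct initial positions the system admits a unique smooth global solution whose trajectories satisfy x_i(t)≠x_j(t) for all i≠j and all t≥0. -/

import Mathlib

/-- A global-in-time, collision-free solution of the `d`-dimensional Cucker–Smale system with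
communication weight `ψ(s) = s^(-α)` and initial data `(x₀, v₀)`. -/
def IsGlobalCSSol (d N : ℕ) (α : ℝ) (x₀ v₀ : Fin N → EuclideanSpace ℝ (Fin d))
    (X V : ℝ → Fin N → EuclideanSpace ℝ (Fin d)) : Prop :=
  X 0 = x₀ ∧ V 0 = v₀ ∧
  (∀ i, ∀ t : ℝ, 0 ≤ t → HasDerivAt (fun s => X s i) (V t i) t) ∧
  (∀ i, ∀ t : ℝ, 0 ≤ t → HasDerivAt (fun s => V s i)
      ((N : ℝ)⁻¹ • ∑ j, (‖X t i - X t j‖ ^ (-α)) • (V t j - V t i)) t) ∧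
  (∀ t : ℝ, 0 ≤ t → ∀ i j : Fin N, i ≠ j → X t i ≠ X t j)

section ODE
open Set Filter Topology

variable {E : Type*} [NormedAddCommGroup E] [NormedSpace ℝ E]

/-- `y` solves `y' = F y` in `U` on `[0,T)` with initial value `y0`. -/
def SolOn (F : E → E) (U : Set E) (y0 : E) (T : ℝ) (y : ℝ → E) : Prop :=
  y 0 = y0 ∧ ∀ t ∈ Ico (0:ℝ) T, y t ∈ U ∧ HasDerivAt y (F (y t)) t

lemma SolOn.unique {F : E → E} {U : Set E} (hF : ∀ y ∈ U, ContDiffAt ℝ 1 F y) {y0 : E}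
    {T T' : ℝ} {y z : ℝ → E} (hy : SolOn F U y0 T y) (hz : SolOn F U y0 T' z) {t : ℝ}
    (ht0 : 0 ≤ t) (htT : t < T) (htT' : t < T') : y t = z t := by
  have cy : ContinuousOn y (Icc 0 t) := fun s hs =>
    (hy.2 s ⟨hs.1, hs.2.trans_lt htT⟩).2.continuousAt.continuousWithinAt
  have cz : ContinuousOn z (Icc 0 t) := fun s hs =>
    (hz.2 s ⟨hs.1, hs.2.trans_lt htT'⟩).2.continuousAt.continuousWithinAt
  set K : Set E := y '' Icc 0 t ∪ z '' Icc 0 t with hK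
  have hKc : IsCompact K := (isCompact_Icc.image_of_continuousOn cy).union
    (isCompact_Icc.image_of_continuousOn cz)
  have hKU : K ⊆ U := by
    rintro _ (⟨s, hs, rfl⟩ | ⟨s, hs, rfl⟩)
    · exact (hy.2 s ⟨hs.1, hs.2.trans_lt htT⟩).1
    · exact (hz.2 s ⟨hs.1, hs.2.trans_lt htT'⟩).1
  have hL : LocallyLipschitzOn K F := by
    intro x hx
    obtain ⟨C, s, hs, hC⟩ := (hF x (hKU hx)).exists_lipschitzOnWith
    exact ⟨C, s, mem_nhdsWithin_of_mem_nhds hs, hC⟩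
  obtain ⟨C, hC⟩ := hL.exists_lipschitzOnWith_of_compact hKc
  refine ODE_solution_unique_of_mem_Icc_right (v := fun _ => F) (s := fun _ => K) (K := C)
    (a := 0) (b := t) (fun _ _ => hC) cy ?_ ?_ cz ?_ ?_ (hy.1.trans hz.1.symm) ⟨ht0, le_rfl⟩
  · exact fun s hs => (hy.2 s ⟨hs.1, hs.2.trans htT⟩).2.hasDerivWithinAt
  · exact fun s hs => Or.inl ⟨s, ⟨hs.1, hs.2.le⟩, rfl⟩
  · exact fun s hs => (hz.2 s ⟨hs.1, hs.2.trans htT'⟩).2.hasDerivWithinAt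
  · exact fun s hs => Or.inr ⟨s, ⟨hs.1, hs.2.le⟩, rfl⟩

lemma SolOn.glue {F : E → E} {U : Set E} (hF : ∀ y ∈ U, ContDiffAt ℝ 1 F y) {y0 : E}
    (hne : ∃ T > 0, ∃ y, SolOn F U y0 T y) :
    ∃ y : ℝ → E, y 0 = y0 ∧ ∀ t, 0 ≤ t → (∃ T > t, ∃ y, SolOn F U y0 T y) →
      y t ∈ U ∧ HasDerivAt y (F (y t)) t := by
  classical
  have key : ∀ t : ℝ, ∃ p : ℝ × (ℝ → E), 
    (∃ T > t, ∃ y, SolOn F U y0 T y) → t < p.1 ∧ SolOn F U y0 p.1 p.2 := by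
    intro t
    by_cases h : ∃ T > t, ∃ y, SolOn F U y0 T y
    · obtain ⟨T, hT, y, hy⟩ := h
      exact ⟨(T, y), fun _ => ⟨hT, hy⟩⟩
    · exact ⟨(0, fun _ => y0), fun h' => absurd h' h⟩
  choose p hp using key
  refine ⟨fun t => (p (max t 0)).2 t, ?_, ?_⟩
  · simpa using (hp 0 hne).2.1
  · intro t ht hT
    obtain ⟨h1, h2⟩ := hp t hT
    have e : (p (max t 0)).2 t = (p t).2 t := by rw [max_eq_left ht]
    simp only [e]
    refine ⟨(h2.2 t ⟨ht, h1⟩).1, (h2.2 t ⟨ht, h1⟩).2.congr_of_eventuallyEq ?_⟩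
    have hpos : ∀ s, 0 ≤ s → s < (p t).1 → (p s).2 s = (p t).2 s := fun s hs hst => by
      obtain ⟨h3, h4⟩ := hp s ⟨_, hst, _, h2⟩
      exact h4.unique hF h2 hs h3 hst
    rcases ht.eq_or_lt with rfl | ht'
    · filter_upwards [Iio_mem_nhds h1] with s hs
      rcases le_total s 0 with h | h
      · rw [max_eq_right h]
      · rw [max_eq_left h]; exact hpos s h hs
    · filter_upwards [Iio_mem_nhds h1, Ioi_mem_nhds ht'] with s hs hs'
      rw [max_eq_left (le_of_lt hs')]
      exact hpos s (le_of_lt hs') hs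

lemma local_sol [CompleteSpace E] {F : E → E} {U : Set E} (hU : IsOpen U)
    (hF : ∀ y ∈ U, ContDiffAt ℝ 1 F y) {y0 : E} (h0 : y0 ∈ U) (T : ℝ) :
    ∃ a : ℝ → E, a T = y0 ∧ ∃ ε > (0:ℝ), ∀ t ∈ Ioo (T - ε) (T + ε), a t ∈ U ∧
      HasDerivAt a (F (a t)) t := by
  obtain ⟨a, ha, ε, hε, h⟩ :=
    (hF y0 h0).exists_forall_mem_closedBall_exists_eq_forall_mem_Ioo_hasDerivAt₀ T
  have hc : ContinuousAt a T := (h T ⟨by linarith, by linarith⟩).continuousAt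
  have : ∀ᶠ t in 𝓝 T, a t ∈ U := hc (by rw [ha]; exact hU.mem_nhds h0)
  obtain ⟨δ, hδ, hd⟩ := Metric.eventually_nhds_iff.1 this
  refine ⟨a, ha, min ε δ, lt_min hε hδ, fun t ht => ⟨hd ?_, h t ?_⟩⟩
  · rw [Real.dist_eq, abs_lt]
    constructor <;> linarith [ht.1, ht.2, min_le_right ε δ]
  · constructor <;> linarith [ht.1, ht.2, min_le_left ε δ]

lemma SolOn.extend [CompleteSpace E] {F : E → E} {U : Set E} (hU : IsOpen U)
    (hF : ∀ y ∈ U, ContDiffAt ℝ 1 F y) {y0 : E} {T : ℝ} (hT : 0 < T) {y : ℝ → E}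
    (hy : SolOn F U y0 T y) {w : E} (hw : w ∈ U) (hlim : Tendsto y (𝓝[<] T) (𝓝 w)) :
    ∃ T' > T, ∃ z, SolOn F U y0 T' z := by
  classical
  obtain ⟨a, ha, ε, hε, h⟩ := local_sol hU hF hw T
  set z : ℝ → E := fun t => if t < T then y t else a t with hz
  have zl : ∀ t, t < T → z t = y t := fun t ht => by simp [hz, ht]
  have zr : ∀ t, T ≤ t → z t = a t := fun t ht => by simp [hz, not_lt.2 ht]
  have zl' : ∀ t, t < T → z =ᶠ[𝓝 t] y := fun t ht => by
    filter_upwards [Iio_mem_nhds ht] with s hs using zl s hs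
  have dl : ∀ t ∈ Ico 0 T, HasDerivAt z (F (z t)) t := fun t ht => by
    rw [zl t ht.2]; exact (hy.2 t ht).2.congr_of_eventuallyEq (zl' t ht.2)
  refine ⟨T + ε, by simpa using hε, z, by rw [zl 0 hT, hy.1], fun t ht => ?_⟩
  rcases lt_trichotomy t T with h1 | h1 | h1
  · exact ⟨by rw [zl t h1]; exact (hy.2 t ⟨ht.1, h1⟩).1, dl t ⟨ht.1, h1⟩⟩
  · subst h1
    have hzt : z t = w := by rw [zr t le_rfl, ha]
    refine ⟨hzt ▸ hw, ?_⟩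
    have hIoo : Ioo 0 t ∈ 𝓝[<] t := Ioo_mem_nhdsLT hT
    have hzlim : Tendsto z (𝓝[<] t) (𝓝 w) := by
      refine hlim.congr' ?_
      filter_upwards [self_mem_nhdsWithin] with s hs using (zl s hs).symm
    have hleft : HasDerivWithinAt z (F (z t)) (Iic t) t := by
      refine hasDerivWithinAt_Iic_of_tendsto_deriv (s := Ioo 0 t) ?_ ?_ hIoo ?_
      · exact fun s hs => (dl s ⟨hs.1.le, hs.2⟩).differentiableAt.differentiableWithinAt
      · rw [ContinuousWithinAt, hzt]
        exact hzlim.mono_left (nhdsWithin_mono _ fun s hs => hs.2)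
      · have : Tendsto (fun s => F (z s)) (𝓝[<] t) (𝓝 (F (z t))) := by
          rw [hzt]; exact (hF w hw).continuousAt.tendsto.comp hzlim
        refine this.congr' ?_
        filter_upwards [hIoo] with s hs using (dl s ⟨hs.1.le, hs.2⟩).deriv.symm
    have hright : HasDerivWithinAt z (F (z t)) (Ici t) t := by
      rw [zr t le_rfl]
      exact ((h t ⟨by linarith, by linarith⟩).2.hasDerivWithinAt).congr
        (fun s hs => zr s hs) (zr t le_rfl)
    simpa using hleft.union hright
  · rw [zr t h1.le]
    have := h t ⟨by linarith, ht.2⟩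
    refine ⟨this.1, this.2.congr_of_eventuallyEq ?_⟩
    filter_upwards [Ioi_mem_nhds h1] with s hs using zr s (le_of_lt hs)

lemma global_sol [CompleteSpace E] {F : E → E} {U : Set E} (hU : IsOpen U)
    (hF : ∀ y ∈ U, ContDiffAt ℝ 1 F y) {y0 : E} (h0 : y0 ∈ U)
    (hap : ∀ T > 0, ∀ y, SolOn F U y0 T y → ∃ w ∈ U, Tendsto y (𝓝[<] T) (𝓝 w)) :
    ∃ y : ℝ → E, y 0 = y0 ∧ ∀ t, 0 ≤ t → y t ∈ U ∧ HasDerivAt y (F (y t)) t := by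
  have hne : ∃ T > 0, ∃ y, SolOn F U y0 T y := by
    obtain ⟨a, ha, ε, hε, h⟩ := local_sol hU hF h0 0
    exact ⟨ε, hε, a, ha, fun t ht => h t ⟨by linarith [ht.1], by linarith [ht.2]⟩⟩
  obtain ⟨y, hy0, hy⟩ := SolOn.glue hF hne
  refine ⟨y, hy0, fun t ht => hy t ht ?_⟩
  by_contra hcon
  set S := {T : ℝ | ∃ y, SolOn F U y0 T y}
  have hb : BddAbove S := ⟨t, fun T hT => by
    by_contra hlt; exact hcon ⟨T, not_le.1 hlt, hT⟩⟩
  obtain ⟨T1, hT1, hS1⟩ := hne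
  have hpos : 0 < sSup S := hT1.trans_le (le_csSup hb hS1)
  have hsol : SolOn F U y0 (sSup S) y := by
    refine ⟨hy0, fun s hs => hy s hs.1 ?_⟩
    obtain ⟨T, hT, hsT⟩ := exists_lt_of_lt_csSup ⟨T1, hS1⟩ hs.2
    exact ⟨T, hsT, hT⟩
  obtain ⟨w, hw, hlim⟩ := hap _ hpos y hsol
  obtain ⟨T', hT', hz⟩ := hsol.extend hU hF hpos hw hlim
  exact absurd (le_csSup hb hz) (not_le.2 hT')

/-- A curve with bounded derivative on `[a,T)` has a limit at `T`. -/
lemma exists_lim_of_bdd_deriv [CompleteSpace E] {f f' : ℝ → E} {a T C : ℝ} (haT : a < T)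
    (hf : ∀ t ∈ Ico a T, HasDerivAt f (f' t) t) (hC : ∀ t ∈ Ico a T, ‖f' t‖ ≤ C) :
    ∃ w, Tendsto f (𝓝[<] T) (𝓝 w) := by
  have hC0 : 0 ≤ C := (norm_nonneg _).trans (hC a ⟨le_rfl, haT⟩)
  have hlip : LipschitzOnWith ⟨C, hC0⟩ f (Ico a T) :=
    (convex_Ico a T).lipschitzOnWith_of_nnnorm_hasDerivWithin_le
      (fun t ht => (hf t ht).hasDerivWithinAt) (fun t ht => hC t ht)
  have hI : Ico a T ∈ 𝓝[<] T := Ico_mem_nhdsLT haT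
  have hc : Cauchy (map f (𝓝[<] T)) :=
    Cauchy.map_of_le (cauchy_nhds.mono nhdsWithin_le_nhds) hlip.uniformContinuousOn
      (le_principal_iff.2 hI)
  exact CompleteSpace.complete hc
end ODE

section Alg
open Set Filter Topology Finset

variable {V : Type*} [NormedAddCommGroup V] [InnerProductSpace ℝ V]

lemma cs_pairs {ι : Type*} (S : Finset ι) (a b : ι → V) :
    |∑ p ∈ S, inner ℝ (a p) (b p)| ≤ √(∑ p ∈ S, ‖a p‖ ^ 2) * √(∑ p ∈ S, ‖b p‖ ^ 2) := by
  refine (Finset.abs_sum_le_sum_abs _ _).trans ?_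
  refine (Finset.sum_le_sum fun p _ => abs_real_inner_le_norm (a p) (b p)).trans ?_
  exact Real.sum_mul_le_sqrt_mul_sqrt S (fun p => ‖a p‖) (fun p => ‖b p‖)

/-- symmetric interaction identity -/
lemma sym_interaction {ι : Type*} (C : Finset ι) (v : ι → V) (w : ι → ι → ℝ)
    (hw : ∀ i j, w i j = w j i) :
    ∑ i ∈ C, inner ℝ (v i) (∑ k ∈ C, w i k • (v k - v i)) =
      -(1/2) * ∑ i ∈ C, ∑ k ∈ C, w i k * ‖v i - v k‖ ^ 2 := by
  have h1 : ∑ i ∈ C, inner ℝ (v i) (∑ k ∈ C, w i k • (v k - v i)) =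
      ∑ i ∈ C, ∑ k ∈ C, w i k * inner ℝ (v i) (v k - v i) := by
    simp [inner_sum, inner_smul_right]
  have h2 : ∑ i ∈ C, ∑ k ∈ C, w i k * inner ℝ (v i) (v k - v i) =
      ∑ i ∈ C, ∑ k ∈ C, w i k * inner ℝ (v k) (v i - v k) := by
    rw [Finset.sum_comm]
    exact Finset.sum_congr rfl fun i _ => Finset.sum_congr rfl fun k _ => by rw [hw]
  have h3 : ∑ i ∈ C, ∑ k ∈ C, w i k * inner ℝ (v i) (v k - v i) +
      ∑ i ∈ C, ∑ k ∈ C, w i k * inner ℝ (v k) (v i - v k) =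
      - ∑ i ∈ C, ∑ k ∈ C, w i k * ‖v i - v k‖ ^ 2 := by
    rw [← Finset.sum_add_distrib, ← Finset.sum_neg_distrib]
    refine Finset.sum_congr rfl fun i _ => ?_
    rw [← Finset.sum_add_distrib, ← Finset.sum_neg_distrib]
    refine Finset.sum_congr rfl fun k _ => ?_
    rw [← real_inner_self_eq_norm_sq]
    simp only [inner_sub_left, inner_sub_right, real_inner_comm (v k) (v i)]
    ring
  rw [h1]; linarith

lemma sum_interaction_zero {ι : Type*} (C : Finset ι) (v : ι → V) (w : ι → ι → ℝ)
    (hw : ∀ i j, w i j = w j i) :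
    ∑ i ∈ C, ∑ k ∈ C, w i k • (v k - v i) = 0 := by
  have h2 : ∑ i ∈ C, ∑ k ∈ C, w i k • (v k - v i) =
      - ∑ i ∈ C, ∑ k ∈ C, w i k • (v k - v i) := by
    conv_lhs => rw [Finset.sum_comm]
    rw [← Finset.sum_neg_distrib]
    refine Finset.sum_congr rfl fun i _ => ?_
    rw [← Finset.sum_neg_distrib]
    refine Finset.sum_congr rfl fun k _ => ?_
    rw [hw k i, ← smul_neg, neg_sub]
  have h3 : (2:ℝ) • ∑ i ∈ C, ∑ k ∈ C, w i k • (v k - v i) = 0 := by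
    rw [two_smul]; nth_rewrite 1 [h2]; exact neg_add_cancel _
  exact (smul_eq_zero.1 h3).resolve_left two_ne_zero

lemma pair_sum {ι : Type*} (C : Finset ι) (v I : ι → V) (hI : ∑ i ∈ C, I i = 0) :
    ∑ p ∈ C ×ˢ C, inner ℝ (v p.1 - v p.2) (I p.1 - I p.2) =
      2 * (#C : ℝ) * ∑ i ∈ C, inner ℝ (v i) (I i) := by
  rw [Finset.sum_product]
  simp only [inner_sub_left, inner_sub_right, Finset.sum_sub_distrib]
  have e1 : ∑ i ∈ C, ∑ j ∈ C, inner ℝ (v i) (I j) = 0 := by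
    refine Finset.sum_eq_zero fun i _ => ?_
    rw [← inner_sum, hI, inner_zero_right]
  have e2 : ∑ i ∈ C, ∑ j ∈ C, inner ℝ (v j) (I i) = 0 := by
    rw [Finset.sum_comm]; exact e1
  rw [e1, e2]
  simp [← Finset.mul_sum]
  ring

/-- dissipation estimate for a cluster -/
lemma cluster_est {N : ℕ} (C : Finset (Fin N)) (x v : Fin N → V) (w : Fin N → Fin N → ℝ)
    (hw : ∀ i j, w i j = w j i) (hw0 : ∀ i j, 0 ≤ w i j) {m K M : ℝ} 
    (hK : 0 ≤ K) (hm : ∀ i ∈ C, ∀ j ∈ C, i ≠ j → m ≤ w i j)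
    (hM : ∀ i j, ‖v i - v j‖ ≤ M)
    (hlip : ∀ i ∈ C, ∀ j ∈ C, ∀ k ∉ C, |w i k - w j k| ≤ K * ‖x i - x j‖) :
    ∑ p ∈ C ×ˢ C, inner ℝ (v p.1 - v p.2)
      ((N:ℝ)⁻¹ • ∑ k, w p.1 k • (v k - v p.1) - (N:ℝ)⁻¹ • ∑ k, w p.2 k • (v k - v p.2)) ≤
    (N:ℝ)⁻¹ * (-(#C : ℝ) * m * ∑ p ∈ C ×ˢ C, ‖v p.1 - v p.2‖ ^ 2 +
      N * (K * M) * (√(∑ p ∈ C ×ˢ C, ‖x p.1 - x p.2‖ ^ 2) *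
        √(∑ p ∈ C ×ˢ C, ‖v p.1 - v p.2‖ ^ 2))) := by
  classical
  set I : Fin N → V := fun i => ∑ k ∈ C, w i k • (v k - v i) with hI
  set J : Fin N → V := fun i => ∑ k ∈ Cᶜ, w i k • (v k - v i) with hJ
  have hsplit : ∀ i, ∑ k, w i k • (v k - v i) = I i + J i := fun i =>
    (Finset.sum_add_sum_compl C _).symm
  have h1 : ∑ p ∈ C ×ˢ C, inner ℝ (v p.1 - v p.2)
      ((N:ℝ)⁻¹ • ∑ k, w p.1 k • (v k - v p.1) - (N:ℝ)⁻¹ • ∑ k, w p.2 k • (v k - v p.2)) =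
      (N:ℝ)⁻¹ * (∑ p ∈ C ×ˢ C, inner ℝ (v p.1 - v p.2) (I p.1 - I p.2) +
        ∑ p ∈ C ×ˢ C, inner ℝ (v p.1 - v p.2) (J p.1 - J p.2)) := by
    rw [← Finset.sum_add_distrib, Finset.mul_sum]
    refine Finset.sum_congr rfl fun p _ => ?_
    rw [hsplit, hsplit, ← smul_sub, inner_smul_right, ← inner_add_right]
    congr 2; abel
  rw [h1]
  refine mul_le_mul_of_nonneg_left (add_le_add ?_ ?_) (by positivity)
  · rw [pair_sum C v I (sum_interaction_zero C v w hw), sym_interaction C v w hw,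
      Finset.sum_product]
    have : m * ∑ i ∈ C, ∑ j ∈ C, ‖v i - v j‖ ^ 2 ≤ ∑ i ∈ C, ∑ k ∈ C, w i k * ‖v i - v k‖ ^ 2 := by
      simp only [Finset.mul_sum]
      refine Finset.sum_le_sum fun i hi => Finset.sum_le_sum fun j hj => ?_
      by_cases hij : i = j
      · subst hij; simp
      · exact mul_le_mul_of_nonneg_right (hm i hi j hj hij) (by positivity)
    have h := mul_le_mul_of_nonneg_left this (Nat.cast_nonneg (α := ℝ) (#C))
    linarith
  · have hterm : ∀ p ∈ C ×ˢ C, inner ℝ (v p.1 - v p.2) (J p.1 - J p.2) ≤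
        N * (K * M) * (‖x p.1 - x p.2‖ * ‖v p.1 - v p.2‖) := by
      rintro ⟨i, j⟩ hp
      obtain ⟨hi, hj⟩ := Finset.mem_product.1 hp
      simp only at hi hj ⊢
      have hM0 : 0 ≤ M := (norm_nonneg _).trans (hM i i)
      have : inner ℝ (v i - v j) (J i - J j) =
          ∑ k ∈ Cᶜ, inner ℝ (v i - v j) (w i k • (v k - v i) - w j k • (v k - v j)) := by
        rw [← inner_sum, Finset.sum_sub_distrib]
      rw [this]
      have hb : ∀ k ∈ Cᶜ, inner ℝ (v i - v j) (w i k • (v k - v i) - w j k • (v k - v j)) ≤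
          (K * M) * (‖x i - x j‖ * ‖v i - v j‖) := by
        intro k hk
        have hk' : k ∉ C := Finset.mem_compl.1 hk
        have e : w i k • (v k - v i) - w j k • (v k - v j) =
          (w i k - w j k) • (v k - v j) - w i k • (v i - v j) := by module
        rw [e, inner_sub_right, inner_smul_right, inner_smul_right, real_inner_self_eq_norm_sq]
        have a1 : (w i k - w j k) * inner ℝ (v i - v j) (v k - v j) ≤
            (K * ‖x i - x j‖) * (‖v i - v j‖ * M) := by
          refine (le_abs_self _).trans ?_
          rw [abs_mul]
          refine mul_le_mul (hlip i hi j hj k hk') ?_ (abs_nonneg _) (by positivity)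
          exact (abs_real_inner_le_norm _ _).trans
            (mul_le_mul_of_nonneg_left (hM k j) (norm_nonneg _))
        have a2 : 0 ≤ w i k * ‖v i - v j‖ ^ 2 := mul_nonneg (hw0 _ _) (by positivity)
        linarith
      refine (Finset.sum_le_card_nsmul _ _ _ hb).trans ?_
      rw [nsmul_eq_mul, mul_assoc (N:ℝ)]
      refine mul_le_mul_of_nonneg_right ?_ (by positivity)
      have := Finset.card_le_univ (Cᶜ : Finset (Fin N))
      rw [Fintype.card_fin] at this
      exact_mod_cast this
    refine (Finset.sum_le_sum hterm).trans ?_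
    rw [← Finset.mul_sum]
    by_cases hN : C.Nonempty
    · obtain ⟨i, hi⟩ := hN
      have hM0 : 0 ≤ M := (norm_nonneg _).trans (hM i i)
      exact mul_le_mul_of_nonneg_left (Real.sum_mul_le_sqrt_mul_sqrt _
        (fun p : Fin N × Fin N => ‖x p.1 - x p.2‖) (fun p => ‖v p.1 - v p.2‖)) (by positivity)
    · rw [Finset.not_nonempty_iff_eq_empty.1 hN]; simp

/-- scalar Lyapunov estimate -/
lemma scalar_est {A B A' B' c Q : ℝ} (hA : 0 < A) (hA1 : A ≤ 1) (hB : 0 ≤ B) (hc : 0 < c)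
    (hQ : 0 ≤ Q) (hA' : |A'| ≤ 2 * (√A * √B))
    (hB' : B' ≤ 2 * (-c * (√A)⁻¹ * B + Q * (√A * √B))) :
    (A' + B') / (2 * √(A + B)) - c / 2 * (A' / A) ≤ 1 + Q + c := by
  obtain ⟨a, ha, rfl⟩ : ∃ a, 0 < a ∧ A = a ^ 2 := ⟨√A, Real.sqrt_pos.2 hA, (Real.sq_sqrt hA.le).symm⟩
  obtain ⟨b, hb, rfl⟩ : ∃ b, 0 ≤ b ∧ B = b ^ 2 := ⟨√B, Real.sqrt_nonneg _, (Real.sq_sqrt hB).symm⟩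
  rw [Real.sqrt_sq ha.le, Real.sqrt_sq hb] at *
  have hg2 : √(a^2+b^2) ^ 2 = a^2 + b^2 := Real.sq_sqrt (by positivity)
  have hg : 0 < √(a^2+b^2) := Real.sqrt_pos.2 (by positivity)
  set g := √(a^2+b^2)
  have hag : a ≤ g := by nlinarith
  have hbg : b ≤ g := by nlinarith
  have ha1 : a ≤ 1 := by nlinarith
  have hAl := (abs_le.1 hA').1
  have hAu := (abs_le.1 hA').2
  have s1 : (A' + B') / (2 * g) ≤ (1 + Q) * a - c * g / a + c := by
    rw [div_le_iff₀ (by positivity)]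
    have e1 : ((1 + Q) * a - c * g / a + c) * (2 * g) = 2 * (1+Q) * a * g - 2 * c * (a⁻¹ * g^2) + 2 * c * g := by
      field_simp
    have e2 : a⁻¹ * g ^ 2 = a + a⁻¹ * b^2 := by rw [hg2]; field_simp
    rw [e1, e2]
    have : (1+Q) * (a * b) ≤ (1+Q) * (a * g) := by gcongr
    have : c * a ≤ c * g := by gcongr
    nlinarith
  have s2 : - (c / 2 * (A' / a^2)) ≤ c * g / a := by
    have : - A' ≤ 2 * (a * g) := by nlinarith
    have e : c * g / a = c / 2 * ((2 * (a * g)) / a^2) := by field_simp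
    rw [e, ← mul_neg, ← neg_div]
    gcongr
  nlinarith

end Alg

section CS
open Set Filter Topology Finset

variable {V : Type*} [NormedAddCommGroup V] [InnerProductSpace ℝ V]

lemma weight_contDiffAt (α : ℝ) {y : V} (hy : y ≠ 0) :
    ContDiffAt ℝ 1 (fun z : V => ‖z‖ ^ (-α)) y :=
  (contDiffAt_norm ℝ hy).rpow_const_of_ne (norm_ne_zero_iff.2 hy)

lemma antitone_aux {f f' : ℝ → ℝ} {a T : ℝ} (hf : ∀ t ∈ Ico a T, HasDerivAt f (f' t) t)
    (hf' : ∀ t ∈ Ico a T, f' t ≤ 0) {t : ℝ} (ht : t ∈ Ico a T) : f t ≤ f a := by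
  have : AntitoneOn f (Ico a T) := by
    refine antitoneOn_of_deriv_nonpos (convex_Ico a T)
      (fun s hs => (hf s hs).continuousAt.continuousWithinAt)
      (fun s hs => (hf s (interior_subset hs)).differentiableAt.differentiableWithinAt) ?_
    intro s hs
    rw [(hf s (interior_subset hs)).deriv]
    exact hf' s (interior_subset hs)
  exact this ⟨le_rfl, ht.1.trans_lt ht.2⟩ ht ht.1

lemma velocity_bound {N : ℕ} (α : ℝ) {t₀ : ℝ} (x v : ℝ → Fin N → V)
    (hv : ∀ i, ∀ t ∈ Set.Ico (0 : ℝ) t₀, HasDerivAt (fun s => v s i)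
      ((N : ℝ)⁻¹ • ∑ j, (‖x t i - x t j‖ ^ (-α)) • (v t j - v t i)) t) :
    ∃ M, 0 ≤ M ∧ ∀ t ∈ Set.Ico (0:ℝ) t₀, ∀ i, ‖v t i‖ ≤ M := by
  refine ⟨√(∑ i, ‖v 0 i‖ ^ 2), Real.sqrt_nonneg _, fun t ht i => ?_⟩
  have h : ∑ i, ‖v t i‖ ^ 2 ≤ ∑ i, ‖v 0 i‖ ^ 2 := by
    refine antitone_aux (f := fun t => ∑ i, ‖v t i‖ ^ 2) (T := t₀)
      (f' := fun t => ∑ i, 2 * inner ℝ (v t i)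
        ((N : ℝ)⁻¹ • ∑ j, (‖x t i - x t j‖ ^ (-α)) • (v t j - v t i))) ?_ ?_ ht
    · exact fun s hs => HasDerivAt.fun_sum fun i _ => (hv i s hs).norm_sq
    · intro s _
      rw [← Finset.mul_sum]
      simp only [inner_smul_right]
      rw [← Finset.mul_sum, sym_interaction Finset.univ (v s)
        (fun i j => ‖x s i - x s j‖ ^ (-α)) (fun i j => by rw [norm_sub_rev])]
      have : 0 ≤ ∑ i, ∑ k, ‖x s i - x s k‖ ^ (-α) * ‖v s i - v s k‖ ^ 2 :=
        Finset.sum_nonneg fun i _ => Finset.sum_nonneg fun k _ => by positivity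
      have hN : (0:ℝ) ≤ (N:ℝ)⁻¹ := by positivity
      have := mul_nonneg hN this
      linarith
  refine Real.le_sqrt_of_sq_le (le_trans ?_ h)
  exact Finset.single_le_sum (f := fun i => ‖v t i‖ ^ 2) (fun i _ => by positivity)
    (Finset.mem_univ i)

lemma no_collision {N : ℕ} (hN : 0 < N) (α : ℝ) (hα : 1 ≤ α) {t₀ : ℝ} (ht₀ : 0 < t₀)
    (x v : ℝ → Fin N → V)
    (hx : ∀ i, ∀ t ∈ Set.Ico (0 : ℝ) t₀, HasDerivAt (fun s => x s i) (v t i) t)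
    (hv : ∀ i, ∀ t ∈ Set.Ico (0 : ℝ) t₀, HasDerivAt (fun s => v s i)
      ((N : ℝ)⁻¹ • ∑ j, (‖x t i - x t j‖ ^ (-α)) • (v t j - v t i)) t)
    (hsep : ∀ t ∈ Set.Ico (0 : ℝ) t₀, ∀ i j : Fin N, i ≠ j → x t i ≠ x t j)
    (xbar : Fin N → V)
    (hlim : ∀ i, Filter.Tendsto (fun t => x t i) (nhdsWithin t₀ (Set.Iio t₀)) (nhds (xbar i)))
    (l l' : Fin N) (hll : l ≠ l') (heq : xbar l = xbar l') : False := by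
  classical
  obtain ⟨M, hM0, hM⟩ := velocity_bound α x v hv
  set C : Finset (Fin N) := Finset.univ.filter (fun k => xbar k = xbar l) with hC
  have memC : ∀ k, k ∈ C ↔ xbar k = xbar l := fun k => by simp [hC]
  have hlC : l ∈ C := (memC l).2 rfl
  have hlC' : l' ∈ C := (memC l').2 heq.symm
  set A : ℝ → ℝ := fun t => ∑ p ∈ C ×ˢ C, ‖x t p.1 - x t p.2‖ ^ 2 with hA
  set B : ℝ → ℝ := fun t => ∑ p ∈ C ×ˢ C, ‖v t p.1 - v t p.2‖ ^ 2 with hB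
  set w : ℝ → Fin N → Fin N → ℝ := fun t i j => ‖x t i - x t j‖ ^ (-α) with hw
  -- Lipschitz constants for exterior weights
  have hlipk : ∀ k, ∃ K : ℝ, 0 ≤ K ∧ (k ∉ C → ∀ᶠ t in 𝓝[<] t₀, ∀ i ∈ C, ∀ j ∈ C,
      |w t i k - w t j k| ≤ K * ‖x t i - x t j‖) := by
    intro k
    by_cases hk : k ∈ C
    · exact ⟨0, le_rfl, fun h => absurd hk h⟩
    · have hne : xbar l - xbar k ≠ 0 := fun h => hk ((memC k).2 (sub_eq_zero.1 h).symm)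
      obtain ⟨K, s, hs, hK⟩ := (weight_contDiffAt α hne).exists_lipschitzOnWith
      refine ⟨K, K.2, fun _ => ?_⟩
      have hin : ∀ i ∈ C, ∀ᶠ t in 𝓝[<] t₀, x t i - x t k ∈ s := by
        intro i hi
        have := (hlim i).sub (hlim k)
        rw [(memC i).1 hi] at this
        exact this hs
      have hall : ∀ᶠ t in 𝓝[<] t₀, ∀ i ∈ C, x t i - x t k ∈ s :=
        (Filter.eventually_all_finset C).2 hin
      filter_upwards [hall] with t ht i hi j hj
      have := hK.dist_le_mul _ (ht i hi) _ (ht j hj)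
      rw [Real.dist_eq, dist_eq_norm] at this
      simpa [hw] using this
  choose Kf hK0 hKf using hlipk
  set K := ∑ k, Kf k with hKdef
  have hKpos : 0 ≤ K := Finset.sum_nonneg fun k _ => hK0 k
  have hlip : ∀ᶠ t in 𝓝[<] t₀, ∀ i ∈ C, ∀ j ∈ C, ∀ k ∉ C,
      |w t i k - w t j k| ≤ K * ‖x t i - x t j‖ := by
    have : ∀ᶠ t in 𝓝[<] t₀, ∀ k, k ∉ C → ∀ i ∈ C, ∀ j ∈ C,
        |w t i k - w t j k| ≤ Kf k * ‖x t i - x t j‖ := by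
      rw [Filter.eventually_all]
      intro k
      by_cases hk : k ∈ C
      · exact Filter.Eventually.of_forall fun t h => absurd hk h
      · filter_upwards [hKf k hk] with t ht _ using ht
    filter_upwards [this] with t ht i hi j hj k hk
    refine (ht k hk i hi j hj).trans (mul_le_mul_of_nonneg_right ?_ (norm_nonneg _))
    exact Finset.single_le_sum (fun k _ => hK0 k) (Finset.mem_univ k)
  -- A tends to zero
  have hAlim : Tendsto A (𝓝[<] t₀) (𝓝 0) := by
    have : Tendsto A (𝓝[<] t₀) (𝓝 (∑ p ∈ C ×ˢ C, ‖xbar p.1 - xbar p.2‖ ^ 2)) :=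
      tendsto_finsetSum _ fun p _ => (((hlim p.1).sub (hlim p.2)).norm.pow 2)
    convert this using 2
    symm
    refine Finset.sum_eq_zero fun p hp => ?_
    obtain ⟨h1, h2⟩ := Finset.mem_product.1 hp
    rw [(memC _).1 h1, (memC _).1 h2]; simp
  have hA1 : ∀ᶠ t in 𝓝[<] t₀, A t ≤ 1 := hAlim.eventually (ge_mem_nhds one_pos)
  have hle : ∀ t, ∀ i ∈ C, ∀ j ∈ C, ‖x t i - x t j‖ ^ 2 ≤ A t := fun t i hi j hj =>
    Finset.single_le_sum (f := fun p : Fin N × Fin N => ‖x t p.1 - x t p.2‖ ^ 2)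
      (fun p _ => by positivity) (Finset.mk_mem_product hi hj)
  have hApos : ∀ t ∈ Ico 0 t₀, 0 < A t := fun t ht => by
    refine lt_of_lt_of_le ?_ (hle t l hlC l' hlC')
    have := norm_pos_iff.2 (sub_ne_zero.2 (hsep t ht l l' hll))
    positivity
  obtain ⟨s, hs, hsub⟩ := mem_nhdsLT_iff_exists_Ico_subset.1 (hlip.and (hA1.and
    (Ico_mem_nhdsLT ht₀)))
  have hs' : s < t₀ := hs
  have hsI : ∀ t ∈ Ico s t₀, t ∈ Ico 0 t₀ := fun t ht => (hsub ht).2.2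
  have hc : 0 < (N:ℝ)⁻¹ * (#C : ℝ) := by
    have : 0 < #C := Finset.card_pos.2 ⟨l, hlC⟩
    positivity
  set c := (N:ℝ)⁻¹ * (#C : ℝ) with hcdef
  set Q := K * (2 * M) with hQ
  set a : ℝ → Fin N → V := fun t i => (N : ℝ)⁻¹ • ∑ j, w t i j • (v t j - v t i) with ha
  set A' : ℝ → ℝ := fun t => ∑ p ∈ C ×ˢ C, 2 * inner ℝ (x t p.1 - x t p.2) (v t p.1 - v t p.2)
  set B' : ℝ → ℝ := fun t => ∑ p ∈ C ×ˢ C, 2 * inner ℝ (v t p.1 - v t p.2) (a t p.1 - a t p.2)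
  have dA : ∀ t ∈ Ico 0 t₀, HasDerivAt A (A' t) t := fun t ht =>
    HasDerivAt.fun_sum fun p _ => ((hx p.1 t ht).fun_sub (hx p.2 t ht)).norm_sq
  have dB : ∀ t ∈ Ico 0 t₀, HasDerivAt B (B' t) t := fun t ht =>
    HasDerivAt.fun_sum fun p _ => ((hv p.1 t ht).fun_sub (hv p.2 t ht)).norm_sq
  have hB0 : ∀ t, 0 ≤ B t := fun t => Finset.sum_nonneg fun p _ => by positivity
  have hA'b : ∀ t, |A' t| ≤ 2 * (√(A t) * √(B t)) := fun t => by
    have := cs_pairs (C ×ˢ C) (fun p => x t p.1 - x t p.2) (fun p => v t p.1 - v t p.2)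
    simp only [A', ← Finset.mul_sum, abs_mul, abs_two]
    exact mul_le_mul_of_nonneg_left this two_pos.le
  have hB'b : ∀ t ∈ Ico s t₀, B' t ≤ 2 * (-c * (√(A t))⁻¹ * B t + Q * (√(A t) * √(B t))) := by
    intro t ht
    have ht0 := hsI t ht
    have hApt := hApos t ht0
    have hsq : 0 < √(A t) := Real.sqrt_pos.2 hApt
    have := cluster_est C (x t) (v t) (w t) (fun i j => by simp only [hw]; rw [norm_sub_rev])
      (fun i j => by simp only [hw]; positivity) (m := (√(A t))⁻¹) (K := K) (M := 2 * M) hKpos ?_ ?_ (hsub ht).1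
    · simp only [B', ← Finset.mul_sum]
      refine mul_le_mul_of_nonneg_left (this.trans (le_of_eq ?_)) two_pos.le
      have hN' : (N:ℝ) ≠ 0 := by positivity
      simp only [hcdef, hQ, hA, hB]
      field_simp
    · intro i hi j hj hij
      have hpos := norm_pos_iff.2 (sub_ne_zero.2 (hsep t ht0 i j hij))
      have hle1 : ‖x t i - x t j‖ ≤ √(A t) := Real.le_sqrt_of_sq_le (hle t i hi j hj)
      have hone : √(A t) ≤ 1 := Real.sqrt_le_one.2 (hsub ht).2.1
      calc (√(A t))⁻¹ ≤ ‖x t i - x t j‖⁻¹ := inv_anti₀ hpos hle1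
        _ = ‖x t i - x t j‖ ^ (-1:ℝ) := (Real.rpow_neg_one _).symm
        _ ≤ ‖x t i - x t j‖ ^ (-α) :=
          Real.rpow_le_rpow_of_exponent_ge hpos (hle1.trans hone) (by linarith)
    · intro i j
      have := norm_sub_le (v t i) (v t j)
      linarith [hM t ht0 i, hM t ht0 j]
  -- Lyapunov function
  set D := 1 + Q + c with hD
  have hQ0 : 0 ≤ Q := by positivity
  have hL : ∀ t ∈ Ico s t₀, √(A t + B t) - c / 2 * Real.log (A t) - D * t ≤
      √(A s + B s) - c / 2 * Real.log (A s) - D * s := by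
    intro t ht
    refine antitone_aux (f := fun t => √(A t + B t) - c / 2 * Real.log (A t) - D * t)
      (f' := fun t => (A' t + B' t) / (2 * √(A t + B t)) - c / 2 * (A' t / A t) - D * 1)
      (T := t₀) ?_ ?_ ht
    · intro r hr
      have hr0 := hsI r hr
      have hp := hApos r hr0
      exact ((((dA r hr0).add (dB r hr0)).sqrt (by have := hB0 r; simp only [Pi.add_apply]; positivity)).sub
        (((dA r hr0).log hp.ne').const_mul (c/2))).sub ((hasDerivAt_id r).const_mul D)
    · intro r hr
      have := scalar_est (hApos r (hsI r hr)) (hsub hr).2.1 (hB0 r) hc hQ0 (hA'b r) (hB'b r hr)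
      linarith
  have hlog : Tendsto (fun t => Real.log (A t)) (𝓝[<] t₀) atBot := by
    refine Real.tendsto_log_nhdsGT_zero.comp (tendsto_nhdsWithin_iff.2 ⟨hAlim, ?_⟩)
    filter_upwards [Ico_mem_nhdsLT ht₀] with t ht using hApos t ht
  set R := √(A s + B s) - c / 2 * Real.log (A s) - D * s with hR
  have hev := hlog.eventually (eventually_lt_atBot (-(R + D * t₀) / (c / 2)))
  obtain ⟨t, h1, h2⟩ := (hev.and (Ico_mem_nhdsLT hs')).exists
  have h3 := hL t h2
  have h4 : Real.log (A t) * (c / 2) < -(R + D * t₀) := (lt_div_iff₀ (by positivity)).1 h1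
  have h5 : D * t ≤ D * t₀ := mul_le_mul_of_nonneg_left h2.2.le (by positivity)
  have h6 := Real.sqrt_nonneg (A t + B t)
  linarith

end CS

section CSGlobal
open Set Filter Topology

/-- The Cucker–Smale vector field on phase space. -/
noncomputable def csField (d N : ℕ) (α : ℝ)
    (y : (Fin N → EuclideanSpace ℝ (Fin d)) × (Fin N → EuclideanSpace ℝ (Fin d))) :
    (Fin N → EuclideanSpace ℝ (Fin d)) × (Fin N → EuclideanSpace ℝ (Fin d)) :=
  (y.2, fun i => (N : ℝ)⁻¹ • ∑ j, (‖y.1 i - y.1 j‖ ^ (-α)) • (y.2 j - y.2 i))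

/-- The collision-free phase space. -/
def csDom (d N : ℕ) :
    Set ((Fin N → EuclideanSpace ℝ (Fin d)) × (Fin N → EuclideanSpace ℝ (Fin d))) :=
  {y | ∀ i j : Fin N, i ≠ j → y.1 i ≠ y.1 j}

lemma isOpen_csDom (d N : ℕ) : IsOpen (csDom d N) := by
  have : csDom d N = ⋂ i : Fin N, ⋂ j : Fin N, ⋂ _ : i ≠ j, {y | y.1 i ≠ y.1 j} := by
    ext y; simp [csDom]
  rw [this]
  refine isOpen_iInter_of_finite fun i => isOpen_iInter_of_finite fun j =>
    isOpen_iInter_of_finite fun _ => isOpen_ne_fun ?_ ?_ <;> fun_prop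

lemma csField_contDiffAt (d N : ℕ) (α : ℝ) :
    ∀ y ∈ csDom d N, ContDiffAt ℝ 1 (csField d N α) y := by
  intro y hy
  refine ContDiffAt.prodMk contDiffAt_snd (contDiffAt_pi.2 fun i => ?_)
  refine ContDiffAt.const_smul _ (ContDiffAt.sum fun j _ => ?_)
  by_cases hij : i = j
  · subst hij; simpa using contDiffAt_const
  · have h1 : ContDiffAt ℝ 1 (fun y : (Fin N → EuclideanSpace ℝ (Fin d)) ×
        (Fin N → EuclideanSpace ℝ (Fin d)) => y.1 i - y.1 j) y := by fun_prop
    have h2 : ContDiffAt ℝ 1 (fun y : (Fin N → EuclideanSpace ℝ (Fin d)) ×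
        (Fin N → EuclideanSpace ℝ (Fin d)) => y.2 j - y.2 i) y := by fun_prop
    have hw : ContDiffAt ℝ 1 (fun z : EuclideanSpace ℝ (Fin d) => ‖z‖ ^ (-α)) (y.1 i - y.1 j) :=
      weight_contDiffAt α (sub_ne_zero.2 (hy i j hij))
    have h3 := ContDiffAt.comp y hw h1
    exact h3.smul h2

lemma csField_hasDerivAt_iff (d N : ℕ) (α : ℝ) (X V : ℝ → Fin N → EuclideanSpace ℝ (Fin d))
    (t : ℝ) : HasDerivAt (fun s => (X s, V s)) (csField d N α (X t, V t)) t ↔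
      (∀ i, HasDerivAt (fun s => X s i) (V t i) t) ∧
      (∀ i, HasDerivAt (fun s => V s i)
      ((N : ℝ)⁻¹ • ∑ j, (‖X t i - X t j‖ ^ (-α)) • (V t j - V t i)) t) := by
  constructor
  · intro h
    have h1 : HasDerivAt X (V t) t := h.fst
    have h2 := h.snd
    exact ⟨fun i => hasDerivAt_pi.1 h1 i, fun i => hasDerivAt_pi.1 h2 i⟩
  · rintro ⟨h1, h2⟩
    exact (hasDerivAt_pi.2 h1).prodMk (hasDerivAt_pi.2 h2)

lemma cs_apriori (d N : ℕ) (hN : 0 < N) (α : ℝ) (hα : 1 ≤ α)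
    (y0 : (Fin N → EuclideanSpace ℝ (Fin d)) × (Fin N → EuclideanSpace ℝ (Fin d))) :
    ∀ T > 0, ∀ y, SolOn (csField d N α) (csDom d N) y0 T y →
      ∃ w ∈ csDom d N, Tendsto y (𝓝[<] T) (𝓝 w) := by
  intro T hT y hy
  set x : ℝ → Fin N → EuclideanSpace ℝ (Fin d) := fun t => (y t).1 with hxdef
  set v : ℝ → Fin N → EuclideanSpace ℝ (Fin d) := fun t => (y t).2 with hvdef
  have hder : ∀ t ∈ Ico 0 T, _ := fun t ht => (csField_hasDerivAt_iff d N α x v t).1 (hy.2 t ht).2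
  have hx := fun i t ht => (hder t ht).1 i
  have hv := fun i t ht => (hder t ht).2 i
  have hsep : ∀ t ∈ Set.Ico (0 : ℝ) T, ∀ i j : Fin N, i ≠ j → x t i ≠ x t j :=
    fun t ht => (hy.2 t ht).1
  obtain ⟨M, hM0, hM⟩ := velocity_bound α x v hv
  have hxl : ∀ i, ∃ w, Tendsto (fun t => x t i) (𝓝[<] T) (𝓝 w) := fun i =>
    exists_lim_of_bdd_deriv hT (hx i) (fun t ht => hM t ht i)
  choose xbar hxbar using hxl
  have hdist : ∀ i j, i ≠ j → xbar i ≠ xbar j := fun i j hij h =>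
    no_collision hN α hα hT x v hx hv hsep xbar hxbar i j hij h
  have hvl : ∀ i, ∃ w, Tendsto (fun t => v t i) (𝓝[<] T) (𝓝 w) := by
    intro i
    have hj : ∀ j, ∀ᶠ t in 𝓝[<] T,
        ‖(‖x t i - x t j‖ ^ (-α)) • (v t j - v t i)‖ ≤
          (‖xbar i - xbar j‖ ^ (-α) + 1) * (M + M) := by
      intro j
      by_cases hij : i = j
      · subst hij
        refine Eventually.of_forall fun t => ?_
        simp only [sub_self, smul_zero, norm_zero]; positivity
      · have hc : Tendsto (fun t => ‖x t i - x t j‖ ^ (-α)) (𝓝[<] T)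
            (𝓝 (‖xbar i - xbar j‖ ^ (-α))) :=
          (weight_contDiffAt α (sub_ne_zero.2 (hdist i j hij))).continuousAt.tendsto.comp
            ((hxbar i).sub (hxbar j))
        filter_upwards [hc.eventually (ge_mem_nhds (lt_add_one _)), Ico_mem_nhdsLT hT] with t h1 h2
        rw [norm_smul, Real.norm_of_nonneg (by positivity)]
        refine mul_le_mul h1 ((norm_sub_le _ _).trans (add_le_add (hM t h2 j) (hM t h2 i)))
          (norm_nonneg _) (by positivity)
    obtain ⟨s, hs, hsub⟩ := mem_nhdsLT_iff_exists_Ico_subset.1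
      ((Filter.eventually_all.2 hj).and (Ico_mem_nhdsLT hT))
    refine exists_lim_of_bdd_deriv (a := s)
      (C := ‖(N:ℝ)⁻¹‖ * ∑ j, (‖xbar i - xbar j‖ ^ (-α) + 1) * (M + M)) hs
      (fun t ht => hv i t (hsub ht).2) (fun t ht => ?_)
    rw [norm_smul]
    refine mul_le_mul_of_nonneg_left ?_ (norm_nonneg _)
    exact (norm_sum_le _ _).trans (Finset.sum_le_sum fun j _ => (hsub ht).1 j)
  choose vbar hvbar using hvl
  refine ⟨(xbar, vbar), hdist, ?_⟩
  have h1 : Tendsto x (𝓝[<] T) (𝓝 xbar) := tendsto_pi_nhds.2 hxbar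
  have h2 : Tendsto v (𝓝[<] T) (𝓝 vbar) := tendsto_pi_nhds.2 hvbar
  exact h1.prodMk_nhds h2

end CSGlobal

/-- Let `d ≥ 1` and `α ≥ 1`.  Suppose `(x, v)` is a `C¹` solution of the
Cucker–Smale system with singular communication weight `ψ(s) = s^(-α)` on `[0, t₀)` such that
the initial positions are pairwise distinct and the positions remain pairwise distinct on
`[0, t₀)`.  Then `t₀` cannot be a first collision time: the continuous extensions `x̄` of the
trajectories to `t = t₀` still satisfy `x̄ i ≠ x̄ j` for all `i ≠ j`.  Consequently, for
pairwise distinct initial positions the system admits a unique smooth global solution whose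
trajectories satisfy `x_i(t) ≠ x_j(t)` for all `i ≠ j` and all `t ≥ 0`. -/
theorem cucker_smale_no_first_collision
    (d N : ℕ) (hd : 1 ≤ d) (hN : 0 < N) (α : ℝ) (hα : 1 ≤ α) (t₀ : ℝ) (ht₀ : 0 < t₀)
    (x v : ℝ → Fin N → EuclideanSpace ℝ (Fin d))
    (hx : ∀ i, ∀ t ∈ Set.Ico (0 : ℝ) t₀, HasDerivAt (fun s => x s i) (v t i) t)
    (hv : ∀ i, ∀ t ∈ Set.Ico (0 : ℝ) t₀, HasDerivAt (fun s => v s i)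
      ((N : ℝ)⁻¹ • ∑ j, (‖x t i - x t j‖ ^ (-α)) • (v t j - v t i)) t)
    (hsep0 : ∀ i j : Fin N, i ≠ j → x 0 i ≠ x 0 j)
    (hsep : ∀ t ∈ Set.Ico (0 : ℝ) t₀, ∀ i j : Fin N, i ≠ j → x t i ≠ x t j)
    (xbar : Fin N → EuclideanSpace ℝ (Fin d))
    (hlim : ∀ i, Filter.Tendsto (fun t => x t i) (nhdsWithin t₀ (Set.Iio t₀)) (nhds (xbar i))) :
    (∀ i j : Fin N, i ≠ j → xbar i ≠ xbar j) ∧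
    (∀ x₀ v₀ : Fin N → EuclideanSpace ℝ (Fin d), (∀ i j : Fin N, i ≠ j → x₀ i ≠ x₀ j) →
      ∃ X V : ℝ → Fin N → EuclideanSpace ℝ (Fin d), IsGlobalCSSol d N α x₀ v₀ X V ∧
        ∀ X' V' : ℝ → Fin N → EuclideanSpace ℝ (Fin d), IsGlobalCSSol d N α x₀ v₀ X' V' →
          ∀ t : ℝ, 0 ≤ t → X' t = X t ∧ V' t = V t) := by
  refine ⟨fun i j hij h =>
    no_collision hN α hα ht₀ x v hx hv hsep xbar hlim i j hij h, fun x₀ v₀ h0 => ?_⟩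
  obtain ⟨y, hy0, hy⟩ := global_sol (isOpen_csDom d N) (csField_contDiffAt d N α)
    (y0 := (x₀, v₀)) h0 (cs_apriori d N hN α hα (x₀, v₀))
  have hder := fun t ht =>
    (csField_hasDerivAt_iff d N α (fun s => (y s).1) (fun s => (y s).2) t).1 (hy t ht).2
  refine ⟨fun s => (y s).1, fun s => (y s).2, ⟨by simp [hy0], by simp [hy0],
    fun i t ht => (hder t ht).1 i, fun i t ht => (hder t ht).2 i, fun t ht => (hy t ht).1⟩, ?_⟩
  rintro X' V' ⟨hX0, hV0, hX, hV, hS⟩ t ht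
  have hs1 : SolOn (csField d N α) (csDom d N) (x₀, v₀) (t + 1) (fun s => (X' s, V' s)) :=
    ⟨by simp [hX0, hV0], fun s hs => ⟨hS s hs.1, (csField_hasDerivAt_iff d N α X' V' s).2
      ⟨fun i => hX i s hs.1, fun i => hV i s hs.1⟩⟩⟩
  have hs2 : SolOn (csField d N α) (csDom d N) (x₀, v₀) (t + 1) y :=
    ⟨hy0, fun s hs => hy s hs.1⟩
  have := hs1.unique (csField_contDiffAt d N α) hs2 ht (lt_add_one t) (lt_add_one t)
  exact ⟨congrArg Prod.fst this, congrArg Prod.snd this⟩
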